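/- In the presented group S: every subgroup of index 4 whose abelianization is infinite has abelianization isomorphic either to ℤ or to ℤ × ℤ/2ℤ; subgroups of index 4 of both kinds exist; and any two subgroups of index 4 with infinite abelianization whose abelianizations are isomorphic are conjugate in S. -/

import Mathlib

open scoped Pointwise

/-- The generator `a` of the free group on five generators. -/
private def a : FreeGroup (Fin 5) := FreeGroup.of 0

/-- The generator `b` of the free group on five generators. -/
private def b : FreeGroup (Fin 5) := FreeGroup.of 1

/-- The generator `c` of the free group on five generators. -/
private def c : FreeGroup (Fin 5) := FreeGroup.of 2

/-- The generator `d` of the free group on five generators. -/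
private def d : FreeGroup (Fin 5) := FreeGroup.of 3

/-- The generator `e` of the free group on five generators. -/
private def e : FreeGroup (Fin 5) := FreeGroup.of 4

/-- Riley's presentation of the maximal discrete subgroup of `Isom(ℍ³)` containing the
knot group `π₁(S³ ∖ 6₃)`. -/
private abbrev S : Type :=
  PresentedGroup
    ({b * d * b * a, c⁻¹ * d * b * e⁻¹ * a * e * a, a ^ 2, b ^ 2, (b * c) ^ 2,
      c ^ 2, d ^ 2, e * d⁻¹ * c * e} : Set (FreeGroup (Fin 5)))
namespace RileyS

/-- Permutations of four points. -/
abbrev P := Equiv.Perm (Fin 4)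

/-- The relations of `S`, rewritten without inverses. -/
def Rels {G : Type*} [Group G] (a b c d e : G) : Prop :=
  b * d * b * a = 1 ∧ a * e * a = e * b * d * c ∧ a * a = 1 ∧ b * b = 1 ∧
    b * c * b * c = 1 ∧ c * c = 1 ∧ d * d = 1 ∧ e * d * c * e = 1

instance {G : Type*} [Group G] [DecidableEq G] (a b c d e : G) : Decidable (Rels a b c d e) := by
  unfold Rels; infer_instance

/-- The images of the generators in `S`. -/
def gen (i : Fin 5) : S := PresentedGroup.of i

theorem inv_eq_self_of_mul_self {G : Type*} [Group G] {x : G} (h : x * x = 1) : x⁻¹ = x :=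
  inv_eq_of_mul_eq_one_left h

theorem gen_rels : Rels (gen 0) (gen 1) (gen 2) (gen 3) (gen 4) := by
  have key : ∀ r ∈ ({b * d * b * a, c⁻¹ * d * b * e⁻¹ * a * e * a, a ^ 2, b ^ 2, (b * c) ^ 2,
      c ^ 2, d ^ 2, e * d⁻¹ * c * e} : Set (FreeGroup (Fin 5))),
      PresentedGroup.mk ({b * d * b * a, c⁻¹ * d * b * e⁻¹ * a * e * a, a ^ 2, b ^ 2, (b * c) ^ 2,
      c ^ 2, d ^ 2, e * d⁻¹ * c * e} : Set (FreeGroup (Fin 5))) r = 1 := by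
    intro r hr
    exact PresentedGroup.one_of_mem hr
  simp only [Set.mem_insert_iff, Set.mem_singleton_iff, forall_eq_or_imp, forall_eq, map_mul,
    map_inv, map_pow] at key
  obtain ⟨h1, h2, h3, h4, h5, h6, h7, h8⟩ := key
  change gen 1 * gen 3 * gen 1 * gen 0 = 1 at h1
  change (gen 2)⁻¹ * gen 3 * gen 1 * (gen 4)⁻¹ * gen 0 * gen 4 * gen 0 = 1 at h2
  change gen 0 ^ 2 = 1 at h3
  change gen 1 ^ 2 = 1 at h4
  change (gen 1 * gen 2) ^ 2 = 1 at h5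
  change gen 2 ^ 2 = 1 at h6
  change gen 3 ^ 2 = 1 at h7
  change gen 4 * (gen 3)⁻¹ * gen 2 * gen 4 = 1 at h8
  rw [pow_two] at h3 h4 h5 h6 h7
  rw [inv_eq_self_of_mul_self h7] at h8
  refine ⟨h1, ?_, h3, h4, by rw [← h5]; group, h6, h7, h8⟩
  have : gen 0 * gen 4 * gen 0 = gen 4 * (gen 1)⁻¹ * (gen 3)⁻¹ * gen 2 *
    ((gen 2)⁻¹ * gen 3 * gen 1 * (gen 4)⁻¹ * gen 0 * gen 4 * gen 0) := by group
  rw [this, h2, inv_eq_self_of_mul_self h7, inv_eq_self_of_mul_self h4, mul_one]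

/-- The universal property of `S`. -/
def lift {G : Type*} [Group G] (x : Fin 5 → G) (h : Rels (x 0) (x 1) (x 2) (x 3) (x 4)) :
    S →* G :=
  PresentedGroup.toGroup (f := x) (by
    obtain ⟨h1, h2, h3, h4, h5, h6, h7, h8⟩ := h
    simp only [Set.mem_insert_iff, Set.mem_singleton_iff, forall_eq_or_imp, forall_eq, map_mul,
      map_inv, map_pow]
    simp only [a, b, c, d, e, FreeGroup.lift_apply_of]
    rw [inv_eq_self_of_mul_self h7]
    refine ⟨h1, ?_, by rw [pow_two, h3], by rw [pow_two, h4], by rw [pow_two, ← h5]; group,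
      by rw [pow_two, h6], by rw [pow_two, h7], h8⟩
    have : (x 2)⁻¹ * x 3 * x 1 * (x 4)⁻¹ * x 0 * x 4 * x 0 =
      (x 2)⁻¹ * x 3 * x 1 * (x 4)⁻¹ * (x 0 * x 4 * x 0) := by group
    rw [this, h2]
    have : (x 2)⁻¹ * x 3 * x 1 * (x 4)⁻¹ * (x 4 * x 1 * x 3 * x 2) =
      (x 2)⁻¹ * (x 3 * (x 1 * x 1) * x 3) * x 2 := by group
    rw [this, h4, mul_one, h7, mul_one, inv_mul_cancel])

theorem lift_gen {G : Type*} [Group G] (x : Fin 5 → G)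
    (h : Rels (x 0) (x 1) (x 2) (x 3) (x 4)) (i : Fin 5) : lift x h (gen i) = x i :=
  PresentedGroup.toGroup.of _

theorem hom_ext {G : Type*} [Group G] {f g : S →* G} (h : ∀ i, f (gen i) = g (gen i)) : f = g :=
  PresentedGroup.ext h

theorem Rels.map {G H : Type*} [Group G] [Group H] (f : G →* H) {a b c d e : G}
    (h : Rels a b c d e) : Rels (f a) (f b) (f c) (f d) (f e) := by
  obtain ⟨h1, h2, h3, h4, h5, h6, h7, h8⟩ := h
  refine ⟨?_, ?_, ?_, ?_, ?_, ?_, ?_, ?_⟩ <;> simp only [← map_mul, *, map_one]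

/-- The wreath product of `B` with the symmetric group on four points. -/
@[ext] structure W (B : Type*) where
  /-- permutation part -/
  p : P
  /-- vector part -/
  v : Fin 4 → B

namespace W
variable {B : Type*} [AddCommGroup B]

instance : Mul (W B) := ⟨fun x y => ⟨x.p * y.p, fun i => x.v (y.p i) + y.v i⟩⟩
instance : One (W B) := ⟨⟨1, 0⟩⟩
instance : Inv (W B) := ⟨fun x => ⟨x.p⁻¹, fun i => - x.v (x.p⁻¹ i)⟩⟩

@[simp] theorem mul_p (x y : W B) : (x * y).p = x.p * y.p := rfl
@[simp] theorem mul_v (x y : W B) (i : Fin 4) : (x * y).v i = x.v (y.p i) + y.v i := rfl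
@[simp] theorem one_p : (1 : W B).p = 1 := rfl
@[simp] theorem one_v (i : Fin 4) : (1 : W B).v i = 0 := rfl
@[simp] theorem inv_p (x : W B) : x⁻¹.p = x.p⁻¹ := rfl
@[simp] theorem inv_v (x : W B) (i : Fin 4) : x⁻¹.v i = - x.v (x.p⁻¹ i) := rfl

instance : Group (W B) := Group.ofLeftAxioms
  (fun x y z => by
    refine W.ext (mul_assoc _ _ _) (funext fun i => ?_)
    simp [add_assoc])
  (fun x => by
    refine W.ext (one_mul _) (funext fun i => ?_)
    simp)
  (fun x => by
    refine W.ext (inv_mul_cancel _) (funext fun i => ?_)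
    simp)

/-- functoriality of `W` -/
def map {C : Type*} [AddCommGroup C] (j : B →+ C) : W B →* W C where
  toFun x := ⟨x.p, fun i => j (x.v i)⟩
  map_one' := W.ext rfl (funext fun i => by simp)
  map_mul' x y := W.ext rfl (funext fun i => by simp)

end W

/-- The stabilizer of the point `0`. -/
def Kst (φ : S →* P) : Subgroup S where
  carrier := {s | φ s 0 = 0}
  one_mem' := by simp
  mul_mem' := by
    intro x y hx hy
    simp only [Set.mem_ofPred_eq] at *
    simp [hx, hy]
  inv_mem' := by
    intro x hx
    simp only [Set.mem_ofPred_eq] at *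
    rw [map_inv, Equiv.Perm.inv_eq_iff_eq, hx]

theorem mem_Kst {φ : S →* P} {s : S} : s ∈ Kst φ ↔ φ s 0 = 0 := Iff.rfl

theorem index_Kst (φ : S →* P) (h : ∀ i, ∃ s, φ s 0 = i) : (Kst φ).index = 4 := by
  let _ : MulAction S (Fin 4) := MulAction.compHom (Fin 4) φ
  have h1 : Kst φ = MulAction.stabilizer S (0 : Fin 4) := rfl
  have : MulAction.IsPretransitive S (Fin 4) := by
    exact MulAction.isPretransitive_iff_base (0 : Fin 4) |>.2 h
  rw [h1, MulAction.index_stabilizer_of_transitive]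
  simp

theorem schreier_mem (φ : S →* P) (t : Fin 4 → S) (ht : ∀ i, φ (t i) 0 = i) (s : S) (i : Fin 4) :
    (t (φ s i))⁻¹ * s * t i ∈ Kst φ := by
  rw [mem_Kst, map_mul, map_mul, map_inv, Equiv.Perm.mul_apply, Equiv.Perm.mul_apply, ht,
    Equiv.Perm.inv_eq_iff_eq, ht]

/-- The Schreier element. -/
def sch (φ : S →* P) (t : Fin 4 → S) (ht : ∀ i, φ (t i) 0 = i) (s : S) (i : Fin 4) : Kst φ :=
  ⟨(t (φ s i))⁻¹ * s * t i, schreier_mem φ t ht s i⟩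

theorem sch_one (φ : S →* P) (t : Fin 4 → S) (ht : ∀ i, φ (t i) 0 = i) (i : Fin 4) :
    sch φ t ht 1 i = 1 := by
  apply Subtype.ext
  change (t (φ 1 i))⁻¹ * 1 * t i = 1
  rw [map_one, Equiv.Perm.one_apply, mul_one, inv_mul_cancel]

theorem sch_mul (φ : S →* P) (t : Fin 4 → S) (ht : ∀ i, φ (t i) 0 = i) (x y : S) (i : Fin 4) :
    sch φ t ht (x * y) i = sch φ t ht x (φ y i) * sch φ t ht y i := by
  apply Subtype.ext
  change (t (φ (x * y) i))⁻¹ * (x * y) * t i =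
    ((t (φ x (φ y i)))⁻¹ * x * t (φ y i)) * ((t (φ y i))⁻¹ * y * t i)
  rw [map_mul, Equiv.Perm.mul_apply]
  group

/-- The cocycle attached to a homomorphism from the stabilizer to an abelian group. -/
def coc {B : Type*} [AddCommGroup B] (φ : S →* P) (t : Fin 4 → S) (ht : ∀ i, φ (t i) 0 = i)
    (f : Kst φ →* Multiplicative B) : S →* W B where
  toFun s := ⟨φ s, fun i => (f (sch φ t ht s i)).toAdd⟩
  map_one' := by
    refine W.ext (map_one _) (funext fun i => ?_)
    change (f (sch φ t ht 1 i)).toAdd = 0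
    rw [sch_one, map_one, toAdd_one]
  map_mul' x y := by
    refine W.ext (map_mul _ _ _) (funext fun i => ?_)
    change (f (sch φ t ht (x * y) i)).toAdd =
      (f (sch φ t ht x (φ y i))).toAdd + (f (sch φ t ht y i)).toAdd
    rw [sch_mul, map_mul, toAdd_mul]

theorem coc_tree {B : Type*} [AddCommGroup B] (φ : S →* P) (t : Fin 4 → S)
    (ht : ∀ i, φ (t i) 0 = i) (f : Kst φ →* Multiplicative B) (x : S) (i : Fin 4)
    (h : t (φ x i) = x * t i) : (coc φ t ht f x).v i = 0 := by
  change (f (sch φ t ht x i)).toAdd = 0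
  have h1 : sch φ t ht x i = 1 := by
    apply Subtype.ext
    change (t (φ x i))⁻¹ * x * t i = 1
    rw [h, mul_assoc, inv_mul_cancel]
  rw [h1, map_one, toAdd_one]

theorem coc_Kst {B : Type*} [AddCommGroup B] (φ : S →* P) (t : Fin 4 → S)
    (ht : ∀ i, φ (t i) 0 = i) (f : Kst φ →* Multiplicative B) (h0 : t 0 = 1) (k : Kst φ) :
    (coc φ t ht f k).v 0 = (f k).toAdd := by
  change (f (sch φ t ht k 0)).toAdd = _
  have h1 : sch φ t ht k 0 = k := by
    apply Subtype.ext
    change (t (φ k 0))⁻¹ * k * t 0 = k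
    rw [mem_Kst.1 k.2, h0, inv_one, one_mul, mul_one]
  rw [h1]

theorem exists_hom_int {A : Type*} [CommGroup A] [Group.FG A] [Infinite A] :
    ∃ f : A →* Multiplicative ℤ, f ≠ 1 := by
  obtain ⟨n, ι, _, p, hp, e, ⟨E⟩⟩ := AddCommGroup.equiv_free_prod_directSum_zmod (Additive A)
  rcases n with _ | n
  · exfalso
    have : ∀ i, NeZero (p i ^ e i) := fun i => ⟨pow_ne_zero _ (hp i).ne_zero⟩
    have h1 : Finite (DirectSum ι fun i => ZMod (p i ^ e i)) := by
      classical
      exact Finite.of_equiv _ (DirectSum.addEquivProd fun i => ZMod (p i ^ e i)).symm.toEquiv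
    have h2 : Finite (Additive A) := Finite.of_equiv _ E.symm.toEquiv
    have h3 : Finite A := h2
    exact not_finite A
  · let g : Additive A →+ ℤ := ((Finsupp.applyAddHom (0 : Fin (n + 1))).comp
      (AddMonoidHom.fst _ _)).comp E.toAddMonoidHom
    refine ⟨AddMonoidHom.toMultiplicativeRight g, fun h => ?_⟩
    have h1 : g (E.symm (Finsupp.single 0 1, 0)) = 1 := by simp [g]
    have h2 := DFunLike.congr_fun h (E.symm (Finsupp.single 0 1, 0)).toMul
    have h3 : g (E.symm (Finsupp.single 0 1, 0)) = 0 := h2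
    omega

/-- If all cocycles with values in `ℤ` are trivial, the abelianization is finite. -/
theorem not_infinite (φ : S →* P) (t : Fin 4 → S) (ht : ∀ i, φ (t i) 0 = i) (h0 : t 0 = 1)
    (H : ∀ Φ : S →* W ℤ, (∀ s, (Φ s).p = φ s) →
      (∀ x i, t (φ x i) = x * t i → (Φ x).v i = 0) → ∀ k i, (Φ (gen k)).v i = 0) :
    ¬ Infinite (Abelianization (Kst φ)) := by
  intro hinf
  have : Group.FG S :=
    Group.fg_of_surjective (f := PresentedGroup.mk _) (PresentedGroup.mk_surjective _)
  have : (Kst φ).FiniteIndex := ⟨by rw [index_Kst φ fun i => ⟨t i, ht i⟩]; norm_num⟩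
  have : Group.FG (Abelianization (Kst φ)) :=
    Group.fg_of_surjective (f := Abelianization.of) (QuotientGroup.mk_surjective)
  obtain ⟨f, hf⟩ := exists_hom_int (A := Abelianization (Kst φ))
  apply hf
  apply Abelianization.hom_ext
  ext k
  set Φ := coc φ t ht (f.comp Abelianization.of) with hΦ
  have h1 := H Φ (fun _ => rfl) (coc_tree φ t ht _)
  have h2 : (W.map (0 : ℤ →+ ℤ)).comp Φ = Φ := hom_ext fun i =>
    W.ext rfl (funext fun j => by rw [h1]; rfl)
  have h3 := coc_Kst φ t ht (f.comp Abelianization.of) h0 k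
  rw [← hΦ, ← h2] at h3
  exact h3.symm

/-- From a cocycle to a homomorphism. -/
def homOf {B : Type*} [AddCommGroup B] (φ : S →* P) (Ψ : S →* W B) (h : ∀ s, (Ψ s).p = φ s) :
    Kst φ →* Multiplicative B where
  toFun k := Multiplicative.ofAdd ((Ψ k).v 0)
  map_one' := by simp
  map_mul' x y := by
    have := y.2
    rw [mem_Kst] at this
    simp [h, this]

theorem iso_of {B : Type*} [AddCommGroup B] (φ : S →* P) (t : Fin 4 → S)
    (ht : ∀ i, φ (t i) 0 = i) (h0 : t 0 = 1) (Ψ : S →* W B) (h : ∀ s, (Ψ s).p = φ s)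
    (hs : ∀ x : Multiplicative B, ∃ k, homOf φ Ψ h k = x)
    (H : ∀ (A : Type) [AddCommGroup A] (Φ : S →* W A), (∀ s, (Φ s).p = φ s) →
      (∀ x i, t (φ x i) = x * t i → (Φ x).v i = 0) →
      ∃ j : B →+ A, ∀ k i, (Φ (gen k)).v i = j ((Ψ (gen k)).v i)) :
    Nonempty (Abelianization (Kst φ) ≃* Multiplicative B) := by
  let F : Kst φ →* Multiplicative (Additive (Abelianization (Kst φ))) :=
    (MulEquiv.toMultiplicative_toAdditive
      (G := Abelianization (Kst φ))).symm.toMonoidHom.comp Abelianization.of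
  obtain ⟨j, hj⟩ := H _ (coc φ t ht F) (fun _ => rfl) (coc_tree φ t ht F)
  have h2 : (W.map j).comp Ψ = coc φ t ht F := hom_ext fun i =>
    W.ext (h _) (funext fun k => (hj _ _).symm)
  refine ⟨MulEquiv.ofBijective (Abelianization.lift (homOf φ Ψ h)) ⟨?_, ?_⟩⟩
  · rw [injective_iff_map_eq_one]
    intro x hx
    obtain ⟨k, rfl⟩ := QuotientGroup.mk_surjective x
    change homOf φ Ψ h k = 1 at hx
    have h3 := coc_Kst φ t ht F h0 k
    rw [← h2] at h3
    change j (homOf φ Ψ h k).toAdd = _ at h3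
    rw [hx] at h3
    simp only [toAdd_one, map_zero] at h3
    exact h3.symm
  · intro x
    obtain ⟨k, hk⟩ := hs x
    exact ⟨Abelianization.of k, by rw [Abelianization.lift_apply_of, hk]⟩

/-- Action tables of seven transitive actions of `S` on four points. -/
def T : Fin 7 → Fin 5 → Fin 4 → Fin 4 :=
  ![![![0, 1, 2, 3], ![1, 0, 3, 2], ![1, 0, 3, 2], ![0, 1, 2, 3], ![2, 3, 1, 0]],
    ![![0, 1, 3, 2], ![0, 1, 2, 3], ![1, 0, 2, 3], ![0, 1, 3, 2], ![2, 3, 1, 0]],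
    ![![0, 1, 3, 2], ![1, 0, 3, 2], ![0, 1, 3, 2], ![0, 1, 3, 2], ![2, 3, 0, 1]],
    ![![1, 0, 3, 2], ![0, 1, 2, 3], ![3, 2, 1, 0], ![1, 0, 3, 2], ![1, 2, 3, 0]],
    ![![1, 0, 3, 2], ![0, 1, 2, 3], ![1, 0, 3, 2], ![1, 0, 3, 2], ![2, 3, 0, 1]],
    ![![1, 0, 3, 2], ![1, 0, 3, 2], ![0, 1, 2, 3], ![1, 0, 3, 2], ![2, 3, 1, 0]],
    ![![1, 0, 3, 2], ![2, 3, 0, 1], ![1, 0, 3, 2], ![1, 0, 3, 2], ![0, 3, 2, 1]]]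

theorem T_inv : ∀ r k i, T r k (T r k (T r k (T r k i))) = i := by decide

/-- The permutations given by the tables. -/
def rep (r : Fin 7) (k : Fin 5) : P where
  toFun := T r k
  invFun i := T r k (T r k (T r k i))
  left_inv := T_inv r k
  right_inv := T_inv r k

theorem T_rels : ∀ r i,
    T r 1 (T r 3 (T r 1 (T r 0 i))) = i ∧
    T r 0 (T r 4 (T r 0 i)) = T r 4 (T r 1 (T r 3 (T r 2 i))) ∧
    T r 0 (T r 0 i) = i ∧ T r 1 (T r 1 i) = i ∧ T r 1 (T r 2 (T r 1 (T r 2 i))) = i ∧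
    T r 2 (T r 2 i) = i ∧ T r 3 (T r 3 i) = i ∧ T r 4 (T r 3 (T r 2 (T r 4 i))) = i := by
  decide +kernel

theorem rep_rels (r : Fin 7) : Rels (rep r 0) (rep r 1) (rep r 2) (rep r 3) (rep r 4) :=
  ⟨Equiv.ext fun i => (T_rels r i).1, Equiv.ext fun i => (T_rels r i).2.1,
    Equiv.ext fun i => (T_rels r i).2.2.1, Equiv.ext fun i => (T_rels r i).2.2.2.1,
    Equiv.ext fun i => (T_rels r i).2.2.2.2.1, Equiv.ext fun i => (T_rels r i).2.2.2.2.2.1,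
    Equiv.ext fun i => (T_rels r i).2.2.2.2.2.2.1, Equiv.ext fun i => (T_rels r i).2.2.2.2.2.2.2⟩

/-- The seven actions. -/
def act (r : Fin 7) : S →* P := lift (rep r) (rep_rels r)

theorem act_gen (r : Fin 7) (k : Fin 5) : act r (gen k) = rep r k := lift_gen _ _ _

theorem act_gen_apply (r : Fin 7) (k : Fin 5) (i : Fin 4) : act r (gen k) i = T r k i := by
  rw [act_gen]; rfl

/-- Transversals. -/
def tr : Fin 7 → Fin 4 → S :=
  ![![1, gen 1, gen 4, gen 4 * gen 1],
    ![1, gen 4 * gen 4, gen 4, gen 0 * gen 4],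
    ![1, gen 1, gen 4, gen 4 * gen 1],
    ![1, gen 0, gen 4 * gen 0, gen 0 * (gen 4 * gen 0)],
    ![1, gen 0, gen 4, gen 4 * gen 0],
    ![1, gen 0, gen 4, gen 4 * gen 0],
    ![1, gen 0, gen 1, gen 1 * gen 0]]

theorem tr_zero (r : Fin 7) : tr r 0 = 1 := by
  fin_cases r <;> rfl

theorem act_tr (r : Fin 7) (i : Fin 4) : act r (tr r i) 0 = i := by
  fin_cases r <;> fin_cases i <;> simp [tr, act_gen_apply, T]

theorem rels_v {B : Type*} [AddCommGroup B] (Φ : S →* W B) (q : Fin 5 → Fin 4 → Fin 4)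
    (hq : ∀ k i, (Φ (gen k)).p i = q k i) (x : Fin 5 → Fin 4 → B)
    (hx : ∀ k i, (Φ (gen k)).v i = x k i) (i : Fin 4) :
    (x 1 (q 3 (q 1 (q 0 i))) + x 3 (q 1 (q 0 i)) + x 1 (q 0 i) + x 0 i = 0) ∧
    (x 0 (q 4 (q 0 i)) + x 4 (q 0 i) + x 0 i =
      x 4 (q 1 (q 3 (q 2 i))) + x 1 (q 3 (q 2 i)) + x 3 (q 2 i) + x 2 i) ∧
    x 0 (q 0 i) + x 0 i = 0 ∧ x 1 (q 1 i) + x 1 i = 0 ∧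
    (x 1 (q 2 (q 1 (q 2 i))) + x 2 (q 1 (q 2 i)) + x 1 (q 2 i) + x 2 i = 0) ∧
    x 2 (q 2 i) + x 2 i = 0 ∧ x 3 (q 3 i) + x 3 i = 0 ∧
    (x 4 (q 3 (q 2 (q 4 i))) + x 3 (q 2 (q 4 i)) + x 2 (q 4 i) + x 4 i = 0) := by
  obtain ⟨h1, h2, h3, h4, h5, h6, h7, h8⟩ := gen_rels.map Φ
  have g1 := congrArg (fun w => w.v i) h1
  have g2 := congrArg (fun w => w.v i) h2
  have g3 := congrArg (fun w => w.v i) h3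
  have g4 := congrArg (fun w => w.v i) h4
  have g5 := congrArg (fun w => w.v i) h5
  have g6 := congrArg (fun w => w.v i) h6
  have g7 := congrArg (fun w => w.v i) h7
  have g8 := congrArg (fun w => w.v i) h8
  simp only [W.mul_v, W.one_v, hq, hx] at g1 g2 g3 g4 g5 g6 g7 g8
  exact ⟨g1, g2, g3, g4, g5, g6, g7, g8⟩

theorem fin0 : ¬ Infinite (Abelianization (Kst (act 0))) := by
  refine not_infinite _ (tr 0) (act_tr 0) (tr_zero 0) fun Φ hp ht => ?_
  have R := rels_v Φ (T 0) (fun k i => by rw [hp, act_gen_apply]) _ (fun k i => rfl)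
  have t1 := ht (gen 1) 0 (by rw [act_gen_apply]; simp [T, tr])
  have t2 := ht (gen 4) 0 (by rw [act_gen_apply]; simp [T, tr])
  have t3 := ht (gen 4) 1 (by rw [act_gen_apply]; simp [T, tr])
  have r0 := R 0
  have r1 := R 1
  have r2 := R 2
  have r3 := R 3
  clear R
  simp [T] at r0 r1 r2 r3
  intro k i
  fin_cases k <;> fin_cases i <;> simp <;> omega

theorem fin1 : ¬ Infinite (Abelianization (Kst (act 1))) := by
  refine not_infinite _ (tr 1) (act_tr 1) (tr_zero 1) fun Φ hp ht => ?_
  have R := rels_v Φ (T 1) (fun k i => by rw [hp, act_gen_apply]) _ (fun k i => rfl)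
  have t1 := ht (gen 4) 0 (by rw [act_gen_apply]; simp [T, tr])
  have t2 := ht (gen 0) 2 (by rw [act_gen_apply]; simp [T, tr])
  have t3 := ht (gen 4) 2 (by rw [act_gen_apply]; simp [T, tr])
  have r0 := R 0
  have r1 := R 1
  have r2 := R 2
  have r3 := R 3
  clear R
  simp [T] at r0 r1 r2 r3
  intro k i
  fin_cases k <;> fin_cases i <;> simp <;> omega

theorem fin2 : ¬ Infinite (Abelianization (Kst (act 2))) := by
  refine not_infinite _ (tr 2) (act_tr 2) (tr_zero 2) fun Φ hp ht => ?_
  have R := rels_v Φ (T 2) (fun k i => by rw [hp, act_gen_apply]) _ (fun k i => rfl)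
  have t1 := ht (gen 1) 0 (by rw [act_gen_apply]; simp [T, tr])
  have t2 := ht (gen 4) 0 (by rw [act_gen_apply]; simp [T, tr])
  have t3 := ht (gen 4) 1 (by rw [act_gen_apply]; simp [T, tr])
  have r0 := R 0
  have r1 := R 1
  have r2 := R 2
  have r3 := R 3
  clear R
  simp [T] at r0 r1 r2 r3
  intro k i
  fin_cases k <;> fin_cases i <;> simp <;> omega

theorem fin3 : ¬ Infinite (Abelianization (Kst (act 3))) := by
  refine not_infinite _ (tr 3) (act_tr 3) (tr_zero 3) fun Φ hp ht => ?_
  have R := rels_v Φ (T 3) (fun k i => by rw [hp, act_gen_apply]) _ (fun k i => rfl)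
  have t1 := ht (gen 0) 0 (by rw [act_gen_apply]; simp [T, tr])
  have t2 := ht (gen 4) 1 (by rw [act_gen_apply]; simp [T, tr])
  have t3 := ht (gen 0) 2 (by rw [act_gen_apply]; simp [T, tr])
  have r0 := R 0
  have r1 := R 1
  have r2 := R 2
  have r3 := R 3
  clear R
  simp [T] at r0 r1 r2 r3
  intro k i
  fin_cases k <;> fin_cases i <;> simp <;> omega

theorem fin5 : ¬ Infinite (Abelianization (Kst (act 5))) := by
  refine not_infinite _ (tr 5) (act_tr 5) (tr_zero 5) fun Φ hp ht => ?_
  have R := rels_v Φ (T 5) (fun k i => by rw [hp, act_gen_apply]) _ (fun k i => rfl)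
  have t1 := ht (gen 0) 0 (by rw [act_gen_apply]; simp [T, tr])
  have t2 := ht (gen 4) 0 (by rw [act_gen_apply]; simp [T, tr])
  have t3 := ht (gen 4) 1 (by rw [act_gen_apply]; simp [T, tr])
  have r0 := R 0
  have r1 := R 1
  have r2 := R 2
  have r3 := R 3
  clear R
  simp [T] at r0 r1 r2 r3
  intro k i
  fin_cases k <;> fin_cases i <;> simp <;> omega

/-- Values of the universal cocycle of the sixth action. -/
def Z6 : Fin 5 → Fin 4 → ℤ :=
  ![![0, 0, 0, 0], ![0, 0, 0, 0], ![2, -2, 2, -2], ![0, 0, 0, 0], ![-1, 1, -1, 1]]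

theorem lin6 {A : Type*} [AddCommGroup A] (Φ : S →* W A) (hp : ∀ s, (Φ s).p = act 6 s)
    (ht : ∀ x i, tr 6 (act 6 x i) = x * tr 6 i → (Φ x).v i = 0) :
    ∀ k i, (Φ (gen k)).v i = Z6 k i • (Φ (gen 4)).v 1 := by
  obtain ⟨x, hx⟩ : ∃ x : Fin 5 → Fin 4 → A, ∀ k i, (Φ (gen k)).v i = x k i :=
    ⟨_, fun _ _ => rfl⟩
  have R := rels_v Φ (T 6) (fun k i => by rw [hp, act_gen_apply]) x hx
  have t1 := ht (gen 0) 0 (by rw [act_gen_apply]; simp [T, tr])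
  have t2 := ht (gen 1) 0 (by rw [act_gen_apply]; simp [T, tr])
  have t3 := ht (gen 1) 1 (by rw [act_gen_apply]; simp [T, tr])
  simp only [hx] at t1 t2 t3 ⊢
  clear hx hp ht
  have r01 : x 1 2 + x 3 3 + x 1 1 + x 0 0 = 0 := (R 0).1
  have r02 : x 0 3 + x 4 1 + x 0 0 = x 4 2 + x 1 0 + x 3 1 + x 2 0 := (R 0).2.1
  have r03 : x 0 1 + x 0 0 = 0 := (R 0).2.2.1
  have r04 : x 1 2 + x 1 0 = 0 := (R 0).2.2.2.1
  have r05 : x 1 2 + x 2 3 + x 1 1 + x 2 0 = 0 := (R 0).2.2.2.2.1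
  have r06 : x 2 1 + x 2 0 = 0 := (R 0).2.2.2.2.2.1
  have r07 : x 3 1 + x 3 0 = 0 := (R 0).2.2.2.2.2.2.1
  have r08 : x 4 0 + x 3 1 + x 2 0 + x 4 0 = 0 := (R 0).2.2.2.2.2.2.2
  have r11 : x 1 3 + x 3 2 + x 1 0 + x 0 1 = 0 := (R 1).1
  have r12 : x 0 0 + x 4 0 + x 0 1 = x 4 3 + x 1 1 + x 3 0 + x 2 1 := (R 1).2.1
  have r13 : x 0 0 + x 0 1 = 0 := (R 1).2.2.1
  have r14 : x 1 3 + x 1 1 = 0 := (R 1).2.2.2.1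
  have r15 : x 1 3 + x 2 2 + x 1 0 + x 2 1 = 0 := (R 1).2.2.2.2.1
  have r16 : x 2 0 + x 2 1 = 0 := (R 1).2.2.2.2.2.1
  have r17 : x 3 0 + x 3 1 = 0 := (R 1).2.2.2.2.2.2.1
  have r18 : x 4 3 + x 3 2 + x 2 3 + x 4 1 = 0 := (R 1).2.2.2.2.2.2.2
  have r21 : x 1 0 + x 3 1 + x 1 3 + x 0 2 = 0 := (R 2).1
  have r22 : x 0 1 + x 4 3 + x 0 2 = x 4 0 + x 1 2 + x 3 3 + x 2 2 := (R 2).2.1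
  have r23 : x 0 3 + x 0 2 = 0 := (R 2).2.2.1
  have r24 : x 1 0 + x 1 2 = 0 := (R 2).2.2.2.1
  have r25 : x 1 0 + x 2 1 + x 1 3 + x 2 2 = 0 := (R 2).2.2.2.2.1
  have r26 : x 2 3 + x 2 2 = 0 := (R 2).2.2.2.2.2.1
  have r27 : x 3 3 + x 3 2 = 0 := (R 2).2.2.2.2.2.2.1
  have r28 : x 4 2 + x 3 3 + x 2 2 + x 4 2 = 0 := (R 2).2.2.2.2.2.2.2
  have r31 : x 1 1 + x 3 0 + x 1 2 + x 0 3 = 0 := (R 3).1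
  have r32 : x 0 2 + x 4 2 + x 0 3 = x 4 1 + x 1 3 + x 3 2 + x 2 3 := (R 3).2.1
  have r33 : x 0 2 + x 0 3 = 0 := (R 3).2.2.1
  have r34 : x 1 1 + x 1 3 = 0 := (R 3).2.2.2.1
  have r35 : x 1 1 + x 2 0 + x 1 2 + x 2 3 = 0 := (R 3).2.2.2.2.1
  have r36 : x 2 2 + x 2 3 = 0 := (R 3).2.2.2.2.2.1
  have r37 : x 3 2 + x 3 3 = 0 := (R 3).2.2.2.2.2.2.1
  have r38 : x 4 1 + x 3 0 + x 2 1 + x 4 3 = 0 := (R 3).2.2.2.2.2.2.2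
  have e00 : x 0 0 = (0 : ℤ) • x 4 1 := by
    linear_combination (norm := module) t1
  have e01 : x 0 1 = (0 : ℤ) • x 4 1 := by
    linear_combination (norm := module) r01 - r04 + r11 - r14 - r27 - t1
  have e02 : x 0 2 = (0 : ℤ) • x 4 1 := by
    linear_combination (norm := module) -r01 + r05 - r06 - r07 - r14 - r18 +
      r21 + r27 + r38 + t1 - t2 + t3
  have e03 : x 0 3 = (0 : ℤ) • x 4 1 := by
    linear_combination (norm := module) r01 - r04 - r05 + r06 + r18 - r27 +
      r31 - r38 - t1 + t2 - t3
  have e10 : x 1 0 = (0 : ℤ) • x 4 1 := by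
    linear_combination (norm := module) t2
  have e11 : x 1 1 = (0 : ℤ) • x 4 1 := by
    linear_combination (norm := module) t3
  have e12 : x 1 2 = (0 : ℤ) • x 4 1 := by
    linear_combination (norm := module) r04 - t2
  have e13 : x 1 3 = (0 : ℤ) • x 4 1 := by
    linear_combination (norm := module) r14 - t3
  have e20 : x 2 0 = (2 : ℤ) • x 4 1 := by
    linear_combination (norm := module) r01 - (2 : ℤ) • r02 - (2 : ℤ) • r04 -
      r05 - (2 : ℤ) • r07 + r26 - r28 + (2 : ℤ) • r31 + t1 - (2 : ℤ) • t3
  have e21 : x 2 1 = (-2 : ℤ) • x 4 1 := by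
    linear_combination (norm := module) -r01 + (2 : ℤ) • r02 + (2 : ℤ) • r04 +
      r05 + r06 + (2 : ℤ) • r07 - r26 + r28 - (2 : ℤ) • r31 - t1 + (2 : ℤ) • t3
  have e22 : x 2 2 = (2 : ℤ) • x 4 1 := by
    linear_combination (norm := module) r01 - (2 : ℤ) • r02 - r04 -
      (2 : ℤ) • r05 - (2 : ℤ) • r07 + (2 : ℤ) • r26 - r28 + (2 : ℤ) • r31 + t1 - t2 - t3
  have e23 : x 2 3 = (-2 : ℤ) • x 4 1 := by
    linear_combination (norm := module) -r01 + (2 : ℤ) • r02 + r04 +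
      (2 : ℤ) • r05 + (2 : ℤ) • r07 - r26 + r28 - (2 : ℤ) • r31 - t1 + t2 + t3
  have e30 : x 3 0 = (0 : ℤ) • x 4 1 := by
    linear_combination (norm := module) -r01 + r05 - r06 - r18 + r27 + r38 + t1
  have e31 : x 3 1 = (0 : ℤ) • x 4 1 := by
    linear_combination (norm := module) r01 - r05 + r06 + r07 + r18 - r27 -
      r38 - t1
  have e32 : x 3 2 = (0 : ℤ) • x 4 1 := by
    linear_combination (norm := module) -r01 + r04 + r27 + t1 - t2 + t3
  have e33 : x 3 3 = (0 : ℤ) • x 4 1 := by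
    linear_combination (norm := module) r01 - r04 - t1 + t2 - t3
  have e40 : x 4 0 = (-1 : ℤ) • x 4 1 := by
    linear_combination (norm := module) -r01 + r04 - r11 + r12 + r14 + r27 +
      r38 + t3
  have e41 : x 4 1 = (1 : ℤ) • x 4 1 := by
    module
  have e42 : x 4 2 = (-1 : ℤ) • x 4 1 := by
    linear_combination (norm := module) -r01 + r02 + r04 + r05 + r07 - r26 +
      r28 - r31 + t3
  have e43 : x 4 3 = (1 : ℤ) • x 4 1 := by
    linear_combination (norm := module) (2 : ℤ) • r01 - (2 : ℤ) • r02 -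
      (2 : ℤ) • r04 - (2 : ℤ) • r05 - (2 : ℤ) • r07 + r18 + r26 - r27 - r28 + (2 : ℤ) • r31 - (2 : ℤ) • t3
  intro k i
  fin_cases k <;> fin_cases i
  · exact e00
  · exact e01
  · exact e02
  · exact e03
  · exact e10
  · exact e11
  · exact e12
  · exact e13
  · exact e20
  · exact e21
  · exact e22
  · exact e23
  · exact e30
  · exact e31
  · exact e32
  · exact e33
  · exact e40
  · exact e41
  · exact e42
  · exact e43

/-- Free part of the values of the universal cocycle of the fourth action. -/
def Z4 : Fin 5 → Fin 4 → ℤ :=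
  ![![0, 0, -1, 1], ![0, 0, 0, 0], ![1, -1, 0, 0], ![0, 0, -1, 1], ![0, 0, -1, 1]]

/-- Torsion part of the values of the universal cocycle of the fourth action. -/
def M4 : Fin 5 → Fin 4 → ℤ :=
  ![![0, 0, 0, 0], ![1, 1, 1, 1], ![1, 1, 1, 1], ![0, 0, 0, 0], ![0, 0, 1, 1]]

theorem lin4 {A : Type*} [AddCommGroup A] (Φ : S →* W A) (hp : ∀ s, (Φ s).p = act 4 s)
    (ht : ∀ x i, tr 4 (act 4 x i) = x * tr 4 i → (Φ x).v i = 0) :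
    (Φ (gen 1)).v 0 + (Φ (gen 1)).v 0 = 0 ∧
    ∀ k i, (Φ (gen k)).v i = Z4 k i • (Φ (gen 0)).v 3 + M4 k i • (Φ (gen 1)).v 0 := by
  obtain ⟨x, hx⟩ : ∃ x : Fin 5 → Fin 4 → A, ∀ k i, (Φ (gen k)).v i = x k i :=
    ⟨_, fun _ _ => rfl⟩
  have R := rels_v Φ (T 4) (fun k i => by rw [hp, act_gen_apply]) x hx
  have t1 := ht (gen 0) 0 (by rw [act_gen_apply]; simp [T, tr])
  have t2 := ht (gen 4) 0 (by rw [act_gen_apply]; simp [T, tr])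
  have t3 := ht (gen 4) 1 (by rw [act_gen_apply]; simp [T, tr])
  simp only [hx] at t1 t2 t3 ⊢
  clear hx hp ht
  have r01 : x 1 0 + x 3 1 + x 1 1 + x 0 0 = 0 := (R 0).1
  have r02 : x 0 3 + x 4 1 + x 0 0 = x 4 0 + x 1 0 + x 3 1 + x 2 0 := (R 0).2.1
  have r03 : x 0 1 + x 0 0 = 0 := (R 0).2.2.1
  have r04 : x 1 0 + x 1 0 = 0 := (R 0).2.2.2.1
  have r05 : x 1 0 + x 2 1 + x 1 1 + x 2 0 = 0 := (R 0).2.2.2.2.1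
  have r06 : x 2 1 + x 2 0 = 0 := (R 0).2.2.2.2.2.1
  have r07 : x 3 1 + x 3 0 = 0 := (R 0).2.2.2.2.2.2.1
  have r08 : x 4 2 + x 3 3 + x 2 2 + x 4 0 = 0 := (R 0).2.2.2.2.2.2.2
  have r11 : x 1 1 + x 3 0 + x 1 0 + x 0 1 = 0 := (R 1).1
  have r12 : x 0 2 + x 4 0 + x 0 1 = x 4 1 + x 1 1 + x 3 0 + x 2 1 := (R 1).2.1
  have r13 : x 0 0 + x 0 1 = 0 := (R 1).2.2.1
  have r14 : x 1 1 + x 1 1 = 0 := (R 1).2.2.2.1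
  have r15 : x 1 1 + x 2 0 + x 1 0 + x 2 1 = 0 := (R 1).2.2.2.2.1
  have r16 : x 2 0 + x 2 1 = 0 := (R 1).2.2.2.2.2.1
  have r17 : x 3 0 + x 3 1 = 0 := (R 1).2.2.2.2.2.2.1
  have r18 : x 4 3 + x 3 2 + x 2 3 + x 4 1 = 0 := (R 1).2.2.2.2.2.2.2
  have r21 : x 1 2 + x 3 3 + x 1 3 + x 0 2 = 0 := (R 2).1
  have r22 : x 0 1 + x 4 3 + x 0 2 = x 4 2 + x 1 2 + x 3 3 + x 2 2 := (R 2).2.1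
  have r23 : x 0 3 + x 0 2 = 0 := (R 2).2.2.1
  have r24 : x 1 2 + x 1 2 = 0 := (R 2).2.2.2.1
  have r25 : x 1 2 + x 2 3 + x 1 3 + x 2 2 = 0 := (R 2).2.2.2.2.1
  have r26 : x 2 3 + x 2 2 = 0 := (R 2).2.2.2.2.2.1
  have r27 : x 3 3 + x 3 2 = 0 := (R 2).2.2.2.2.2.2.1
  have r28 : x 4 0 + x 3 1 + x 2 0 + x 4 2 = 0 := (R 2).2.2.2.2.2.2.2
  have r31 : x 1 3 + x 3 2 + x 1 2 + x 0 3 = 0 := (R 3).1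
  have r32 : x 0 0 + x 4 2 + x 0 3 = x 4 3 + x 1 3 + x 3 2 + x 2 3 := (R 3).2.1
  have r33 : x 0 2 + x 0 3 = 0 := (R 3).2.2.1
  have r34 : x 1 3 + x 1 3 = 0 := (R 3).2.2.2.1
  have r35 : x 1 3 + x 2 2 + x 1 2 + x 2 3 = 0 := (R 3).2.2.2.2.1
  have r36 : x 2 2 + x 2 3 = 0 := (R 3).2.2.2.2.2.1
  have r37 : x 3 2 + x 3 3 = 0 := (R 3).2.2.2.2.2.2.1
  have r38 : x 4 1 + x 3 0 + x 2 1 + x 4 3 = 0 := (R 3).2.2.2.2.2.2.2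
  have e00 : x 0 0 = (0 : ℤ) • x 0 3 + (0 : ℤ) • x 1 0 := by
    linear_combination (norm := module) t1
  have e01 : x 0 1 = (0 : ℤ) • x 0 3 + (0 : ℤ) • x 1 0 := by
    linear_combination (norm := module) r01 - (2 : ℤ) • r05 + (2 : ℤ) • r06 -
      r07 + r11 - t1
  have e02 : x 0 2 = (-1 : ℤ) • x 0 3 + (0 : ℤ) • x 1 0 := by
    linear_combination (norm := module) r21 - (2 : ℤ) • r25 + (2 : ℤ) • r26 -
      r27 + r31
  have e03 : x 0 3 = (1 : ℤ) • x 0 3 + (0 : ℤ) • x 1 0 := by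
    module
  have e10 : x 1 0 = (0 : ℤ) • x 0 3 + (1 : ℤ) • x 1 0 := by
    module
  have e11 : x 1 1 = (0 : ℤ) • x 0 3 + (1 : ℤ) • x 1 0 := by
    linear_combination (norm := module) (2 : ℤ) • r01 - (5 : ℤ) • r05 +
      (5 : ℤ) • r06 - (2 : ℤ) • r07 + (2 : ℤ) • r08 + (2 : ℤ) • r11 - (2 : ℤ) • r12 + (2 : ℤ) • r21 - (4 : ℤ) • r25 + (2 : ℤ) • r26 - (4 : ℤ) • r27 + (2 : ℤ) • r31 - (2 : ℤ) • r32 - r34 - (2 : ℤ) • r38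
  have e12 : x 1 2 = (0 : ℤ) • x 0 3 + (1 : ℤ) • x 1 0 := by
    linear_combination (norm := module) r01 - (3 : ℤ) • r05 + (3 : ℤ) • r06 -
      r07 + r08 + r11 - r12 + r21 - r25 - (2 : ℤ) • r27 + r31 - r32 - r34 - r38
  have e13 : x 1 3 = (0 : ℤ) • x 0 3 + (1 : ℤ) • x 1 0 := by
    linear_combination (norm := module) r01 - (3 : ℤ) • r05 + (3 : ℤ) • r06 -
      r07 + r08 + r11 - r12 + r21 - (2 : ℤ) • r25 + r26 - (2 : ℤ) • r27 + r31 - r32 - r38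
  have e20 : x 2 0 = (1 : ℤ) • x 0 3 + (1 : ℤ) • x 1 0 := by
    linear_combination (norm := module) -(2 : ℤ) • r05 + (3 : ℤ) • r06 +
      (2 : ℤ) • r08 + r11 - r12 + r21 - (2 : ℤ) • r25 - (3 : ℤ) • r27 + r31 - (2 : ℤ) • r32 - r34 - (2 : ℤ) • r38 + (2 : ℤ) • t1 - t2 + t3
  have e21 : x 2 1 = (-1 : ℤ) • x 0 3 + (1 : ℤ) • x 1 0 := by
    linear_combination (norm := module) (2 : ℤ) • r01 - (4 : ℤ) • r05 +
      (4 : ℤ) • r06 - (2 : ℤ) • r07 + r11 - r12 + r21 - (2 : ℤ) • r25 + (2 : ℤ) • r26 - r27 + r31 - (2 : ℤ) • t1 + t2 - t3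
  have e22 : x 2 2 = (0 : ℤ) • x 0 3 + (1 : ℤ) • x 1 0 := by
    linear_combination (norm := module) r01 - (3 : ℤ) • r05 + (3 : ℤ) • r06 -
      r07 + (2 : ℤ) • r08 + r11 - r12 - r18 + r21 - (3 : ℤ) • r25 + (2 : ℤ) • r26 - (3 : ℤ) • r27 + (2 : ℤ) • r31 - (2 : ℤ) • r32 - r34 - r38 + t1 - t2 + t3
  have e23 : x 2 3 = (0 : ℤ) • x 0 3 + (1 : ℤ) • x 1 0 := by
    linear_combination (norm := module) r01 - (3 : ℤ) • r05 + (3 : ℤ) • r06 -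
      r07 + r11 - r12 + r18 + r21 - r25 + r26 - r27 - r38 - t1 + t2 - t3
  have e30 : x 3 0 = (0 : ℤ) • x 0 3 + (0 : ℤ) • x 1 0 := by
    linear_combination (norm := module) -r01 + r05 - r06 + r07 + t1
  have e31 : x 3 1 = (0 : ℤ) • x 0 3 + (0 : ℤ) • x 1 0 := by
    linear_combination (norm := module) r01 - r05 + r06 - t1
  have e32 : x 3 2 = (-1 : ℤ) • x 0 3 + (0 : ℤ) • x 1 0 := by
    linear_combination (norm := module) -r25 + r26 + r31
  have e33 : x 3 3 = (1 : ℤ) • x 0 3 + (0 : ℤ) • x 1 0 := by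
    linear_combination (norm := module) r25 - r26 + r27 - r31
  have e40 : x 4 0 = (0 : ℤ) • x 0 3 + (0 : ℤ) • x 1 0 := by
    linear_combination (norm := module) t2
  have e41 : x 4 1 = (0 : ℤ) • x 0 3 + (0 : ℤ) • x 1 0 := by
    linear_combination (norm := module) t3
  have e42 : x 4 2 = (-1 : ℤ) • x 0 3 + (1 : ℤ) • x 1 0 := by
    linear_combination (norm := module) r01 - (3 : ℤ) • r05 + (3 : ℤ) • r06 -
      r07 + r08 + r11 - r12 + r18 + r21 - (2 : ℤ) • r25 + r26 - (2 : ℤ) • r27 + r31 - r38 - t1 - t3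
  have e43 : x 4 3 = (1 : ℤ) • x 0 3 + (1 : ℤ) • x 1 0 := by
    linear_combination (norm := module) r01 - (3 : ℤ) • r05 + (3 : ℤ) • r06 -
      r07 + (2 : ℤ) • r08 + r11 - r12 + r21 - (2 : ℤ) • r25 - (3 : ℤ) • r27 + r31 - (2 : ℤ) • r32 - r34 - r38 + t1 - t2
  refine ⟨r04, ?_⟩
  intro k i
  fin_cases k <;> fin_cases i
  · exact e00
  · exact e01
  · exact e02
  · exact e03
  · exact e10
  · exact e11
  · exact e12
  · exact e13
  · exact e20
  · exact e21
  · exact e22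
  · exact e23
  · exact e30
  · exact e31
  · exact e32
  · exact e33
  · exact e40
  · exact e41
  · exact e42
  · exact e43

/-- The projection to the permutation part. -/
def W.pHom (B : Type*) [AddCommGroup B] : W B →* P where
  toFun := W.p
  map_one' := rfl
  map_mul' _ _ := rfl

theorem lift_p {B : Type*} [AddCommGroup B] (r : Fin 7) (x : Fin 5 → W B)
    (hx : ∀ k, (x k).p = rep r k) (h : Rels (x 0) (x 1) (x 2) (x 3) (x 4)) (s : S) :
    (lift x h s).p = act r s := by
  have : (W.pHom B).comp (lift x h) = act r := hom_ext fun k => by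
    rw [MonoidHom.comp_apply, lift_gen, act_gen]; exact hx k
  exact DFunLike.congr_fun this s

/-- The wreath product data for the sixth action. -/
def w6 (k : Fin 5) : W ℤ := ⟨rep 6 k, Z6 k⟩

theorem w6_rels : Rels (w6 0) (w6 1) (w6 2) (w6 3) (w6 4) := by
  obtain ⟨h1, h2, h3, h4, h5, h6, h7, h8⟩ := rep_rels 6
  refine ⟨W.ext h1 ?_, W.ext h2 ?_, W.ext h3 ?_, W.ext h4 ?_, W.ext h5 ?_, W.ext h6 ?_,
    W.ext h7 ?_, W.ext h8 ?_⟩ <;> decide +kernel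

theorem isoZ : Nonempty (Abelianization (Kst (act 6)) ≃* Multiplicative ℤ) := by
  refine iso_of _ (tr 6) (act_tr 6) (tr_zero 6) (lift w6 w6_rels)
    (lift_p 6 w6 (fun _ => rfl) w6_rels) ?_ ?_
  · intro x
    let k : Kst (act 6) := ⟨gen 0 * gen 1 * gen 4 * gen 0, by
      rw [mem_Kst]; simp only [map_mul, act_gen]; decide +kernel⟩
    refine ⟨k ^ x.toAdd, ?_⟩
    have hk : homOf (act 6) (lift w6 w6_rels) (lift_p 6 w6 (fun _ => rfl) w6_rels) k =
        Multiplicative.ofAdd 1 := by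
      change Multiplicative.ofAdd ((lift w6 w6_rels (gen 0 * gen 1 * gen 4 * gen 0)).v 0) = _
      simp only [map_mul, lift_gen]
      decide +kernel
    rw [map_zpow, hk, ← ofAdd_zsmul]
    simp
  · intro A _ Φ hp ht
    refine ⟨zmultiplesHom A ((Φ (gen 4)).v 1), fun k i => ?_⟩
    rw [lift_gen, zmultiplesHom_apply]
    exact lin6 Φ hp ht k i

/-- The wreath product data for the fourth action. -/
def w4 (k : Fin 5) : W (ℤ × ZMod 2) := ⟨rep 4 k, fun i => (Z4 k i, (M4 k i : ZMod 2))⟩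

theorem w4_rels : Rels (w4 0) (w4 1) (w4 2) (w4 3) (w4 4) := by
  obtain ⟨h1, h2, h3, h4, h5, h6, h7, h8⟩ := rep_rels 4
  refine ⟨W.ext h1 ?_, W.ext h2 ?_, W.ext h3 ?_, W.ext h4 ?_, W.ext h5 ?_, W.ext h6 ?_,
    W.ext h7 ?_, W.ext h8 ?_⟩ <;> decide +kernel

theorem isoZ2 : Nonempty (Abelianization (Kst (act 4)) ≃* Multiplicative (ℤ × ZMod 2)) := by
  have hp4 := lift_p 4 w4 (fun _ => rfl) w4_rels
  refine iso_of _ (tr 4) (act_tr 4) (tr_zero 4) (lift w4 w4_rels) hp4 ?_ ?_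
  · intro x
    let k : Kst (act 4) := ⟨(gen 4)⁻¹ * gen 0 * gen 4 * gen 0, by
      rw [mem_Kst]; simp only [map_mul, map_inv, act_gen]; decide +kernel⟩
    let l : Kst (act 4) := ⟨gen 1, by rw [mem_Kst]; simp only [act_gen]; decide +kernel⟩
    have hk : homOf (act 4) (lift w4 w4_rels) hp4 k = Multiplicative.ofAdd (1, 0) := by
      change Multiplicative.ofAdd
        ((lift w4 w4_rels ((gen 4)⁻¹ * gen 0 * gen 4 * gen 0)).v 0) = _
      simp only [map_mul, map_inv, lift_gen]
      decide +kernel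
    have hl : homOf (act 4) (lift w4 w4_rels) hp4 l = Multiplicative.ofAdd (0, 1) := by
      change Multiplicative.ofAdd ((lift w4 w4_rels (gen 1)).v 0) = _
      simp only [lift_gen]
      decide +kernel
    refine ⟨k ^ x.toAdd.1 * l ^ x.toAdd.2.val, ?_⟩
    rw [map_mul, map_zpow, map_pow, hk, hl, ← ofAdd_zsmul, ← ofAdd_nsmul, ← ofAdd_add]
    apply Multiplicative.toAdd.injective
    ext <;> simp
  · intro A _ Φ hp ht
    obtain ⟨h2, h⟩ := lin4 Φ hp ht
    let j2 : ZMod 2 →+ A := ZMod.lift 2 ⟨zmultiplesHom A ((Φ (gen 1)).v 0), by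
      simpa [two_smul] using h2⟩
    refine ⟨(zmultiplesHom A ((Φ (gen 0)).v 3)).coprod j2, fun k i => ?_⟩
    rw [lift_gen, AddMonoidHom.coprod_apply, h k i]
    simp [w4, j2]

/-- Transitivity of the group generated by three permutations. -/
def Trans (a b e : P) : Prop :=
  ∀ U : Fin 4 → Bool, U 0 = true → (∀ i, U (a i) = U i) → (∀ i, U (b i) = U i) →
    (∀ i, U (e i) = U i) → ∀ i, U i = true

/-- Being conjugate to one of the seven actions. -/
def IsRep (a b e : P) : Prop :=
  ∃ r, ∃ σ : P, a * σ = σ * rep r 0 ∧ b * σ = σ * rep r 1 ∧ e * σ = σ * rep r 4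

/-- Evaluation of a self-map of four points encoded in base four. -/
def ap (p i : ℕ) : ℕ := Nat.land (Nat.shiftRight p (Nat.mul 2 i)) 3

/-- Conjunction over four points. -/
def all4 (f : ℕ → Bool) : Bool := f 0 && f 1 && f 2 && f 3

theorem all4_iff (f : ℕ → Bool) : all4 f = true ↔ ∀ i : Fin 4, f i.val = true := by
  simp [all4, Fin.forall_fin_succ, and_assoc]

/-- The encoding of a permutation. -/
def code (p : P) : ℕ := (p 0).val + 4 * (p 1).val + 16 * (p 2).val + 64 * (p 3).val

/-- The encodings of all permutations. -/
def codes : List ℕ :=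
  [228, 180, 216, 120, 156, 108, 225, 177, 201, 57, 141, 45, 210, 114, 198, 54, 78, 30, 147, 99,
    135, 39, 75, 27]

theorem code_mem : ∀ p : P, code p ∈ codes := by decide +kernel

theorem code_surj : ∀ n ∈ codes, ∃ p : P, code p = n := by decide +kernel

theorem ap_code : ∀ (p : P) (i : Fin 4), ap (code p) i.val = (p i).val := by decide +kernel

/-- The encoded relations. -/
def relsN (a b e : ℕ) : Bool :=
  all4 (fun i => Nat.beq (ap a (ap e (ap a i)))
    (ap e (ap a (ap b (ap e (ap e (ap b (ap a (ap b i)))))))))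
  && all4 (fun i => Nat.beq (ap e (ap e (ap b (ap a (ap b
    (ap e (ap e (ap b (ap a (ap b i)))))))))) i)
  && all4 (fun i => Nat.beq (ap b (ap e (ap e (ap b (ap a (ap b
    (ap b (ap e (ap e (ap b (ap a (ap b i)))))))))))) i)

/-- The encoded failure of transitivity. -/
def splitN (a b e : ℕ) : Bool :=
  [1, 3, 5, 7, 9, 11, 13].any fun m => all4 fun i =>
    (Nat.testBit m (ap a i) == Nat.testBit m i) && (Nat.testBit m (ap b i) == Nat.testBit m i) &&
      (Nat.testBit m (ap e i) == Nat.testBit m i)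

/-- The encodings of the seven actions. -/
def reps : List (ℕ × ℕ × ℕ) :=
  [(228, 177, 30), (180, 228, 30), (180, 177, 78), (177, 228, 57), (177, 228, 78),
    (177, 177, 30), (177, 78, 108)]

theorem reps_eq : ∀ t ∈ reps, ∃ r, code (rep r 0) = t.1 ∧ code (rep r 1) = t.2.1 ∧
    code (rep r 4) = t.2.2 := by
  decide +kernel

/-- The encoded conjugacy with one of the seven actions. -/
def repN (a b e : ℕ) : Bool :=
  reps.any fun t => codes.any fun s =>
      all4 fun i => Nat.beq (ap a (ap s i)) (ap s (ap t.1 i)) &&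
        Nat.beq (ap b (ap s i)) (ap s (ap t.2.1 i)) && Nat.beq (ap e (ap s i)) (ap s (ap t.2.2 i))

/-- The encodings of the permutations with trivial square. -/
def invs : List ℕ := [228, 180, 216, 108, 225, 177, 198, 78, 39, 27]

theorem invs_mem : ∀ p : P, p * p = 1 → code p ∈ invs := by decide +kernel

theorem enumN : (invs.all fun a => invs.all fun b => codes.all fun e =>
    !(relsN a b e) || (splitN a b e || repN a b e)) = true := by
  decide +kernel

theorem relsN_of {a b e : P} (h1 : a * e * a = e * a * b * e * e * b * a * b)
    (h2 : e * e * b * a * b * e * e * b * a * b = 1)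
    (h3 : b * e * e * b * a * b * b * e * e * b * a * b = 1) :
    relsN (code a) (code b) (code e) = true := by
  simp only [relsN, Bool.and_eq_true, all4_iff, ap_code, Nat.beq_eq]
  refine ⟨⟨fun i => ?_, fun i => ?_⟩, fun i => ?_⟩
  · exact congrArg (fun p : P => (p i).val) h1
  · exact congrArg (fun p : P => (p i).val) h2
  · exact congrArg (fun p : P => (p i).val) h3

theorem not_splitN {a b e : P} (h : Trans a b e) : splitN (code a) (code b) (code e) = false := by
  rw [Bool.eq_false_iff]
  intro hs
  simp only [splitN, List.any_eq_true, all4_iff, Bool.and_eq_true, beq_iff_eq, ap_code] at hs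
  obtain ⟨m, hm, H⟩ := hs
  have h0 : ∀ m ∈ [1, 3, 5, 7, 9, 11, 13], Nat.testBit m 0 = true ∧
      ∃ i : Fin 4, Nat.testBit m i.val = false := by decide +kernel
  obtain ⟨i, hi⟩ := (h0 m hm).2
  have := h (fun j => Nat.testBit m j.val) (h0 m hm).1 (fun j => (H j).1.1)
    (fun j => (H j).1.2) (fun j => (H j).2) i
  rw [hi] at this
  exact Bool.false_ne_true this

theorem isRep_of {a b e : P} (h : repN (code a) (code b) (code e) = true) : IsRep a b e := by
  simp only [repN, List.any_eq_true] at h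
  obtain ⟨t, ht, s, hs, H⟩ := h
  obtain ⟨r, e1, e2, e3⟩ := reps_eq t ht
  obtain ⟨σ, rfl⟩ := code_surj s hs
  rw [← e1, ← e2, ← e3] at H
  simp only [Bool.and_eq_true, all4_iff, ap_code, Nat.beq_eq] at H
  exact ⟨r, σ, Equiv.ext fun i => Fin.ext (H i).1.1, Equiv.ext fun i => Fin.ext (H i).1.2,
    Equiv.ext fun i => Fin.ext (H i).2⟩

theorem enum (a b e : P) (ha : a * a = 1) (hb : b * b = 1)
    (h1 : a * e * a = e * a * b * e * e * b * a * b)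
    (h2 : e * e * b * a * b * e * e * b * a * b = 1)
    (h3 : b * e * e * b * a * b * b * e * e * b * a * b = 1) (ht : Trans a b e) :
    IsRep a b e := by
  have H := List.all_eq_true.1 (List.all_eq_true.1 (List.all_eq_true.1 enumN _
    (invs_mem a ha)) _ (invs_mem b hb)) _ (code_mem e)
  rw [relsN_of h1 h2 h3, not_splitN ht] at H
  exact isRep_of (by simpa using H)

theorem d_eq {G : Type*} [Group G] {a b c d e : G} (h : Rels a b c d e) : d = b * a * b := by
  obtain ⟨h1, -, h3, h4, -⟩ := h
  calc d = b⁻¹ * (b * d * b * a) * a⁻¹ * b⁻¹ := by group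
    _ = b * a * b := by
      rw [h1, inv_eq_self_of_mul_self h3, inv_eq_self_of_mul_self h4, mul_one]

theorem c_eq {G : Type*} [Group G] {a b c d e : G} (h : Rels a b c d e) :
    c = b * a * b * e⁻¹ * e⁻¹ := by
  rw [← d_eq h]
  obtain ⟨-, -, -, -, -, -, h7, h8⟩ := h
  calc c = d⁻¹ * e⁻¹ * (e * d * c * e) * e⁻¹ := by group
    _ = d * e⁻¹ * e⁻¹ := by rw [h8, inv_eq_self_of_mul_self h7, mul_one]

theorem rels_abe {G : Type*} [Group G] {a b c d e : G} (h : Rels a b c d e) :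
    a * e * a = e * a * b * e * e * b * a * b ∧ e * e * b * a * b * e * e * b * a * b = 1 ∧
      b * e * e * b * a * b * b * e * e * b * a * b = 1 := by
  have hd := d_eq h
  obtain ⟨-, h2, h3, h4, h5, h6, h7, h8⟩ := h
  have hc : c = e * e * b * a * b := by
    rw [← inv_eq_self_of_mul_self h6]
    calc c⁻¹ = e * (e * d * c * e)⁻¹ * e * d := by group
      _ = e * e * b * a * b := by rw [h8, hd]; group
  refine ⟨?_, ?_, ?_⟩
  · have h9 : e * b * d * c = e * (b * b) * a * b * c := by rw [hd]; group
    rw [h2, h9, h4, hc]; group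
  · rw [← h6, hc]; group
  · rw [← h5, hc]; group

theorem eq_of_rels {G : Type*} [Group G] {f g : S →* G} (h0 : f (gen 0) = g (gen 0))
    (h1 : f (gen 1) = g (gen 1)) (h4 : f (gen 4) = g (gen 4)) : f = g := by
  have h3 : f (gen 3) = g (gen 3) := by
    rw [d_eq (gen_rels.map f), d_eq (gen_rels.map g), h0, h1]
  have h2 : f (gen 2) = g (gen 2) := by
    rw [c_eq (gen_rels.map f), c_eq (gen_rels.map g), h0, h1, h4]
  refine hom_ext fun i => ?_
  fin_cases i
  · exact h0
  · exact h1
  · exact h2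
  · exact h3
  · exact h4

/-- The elements preserving a colouring of the four points. -/
def colour (U : Fin 4 → Bool) : Subgroup P where
  carrier := {s | ∀ i, U (s i) = U i}
  one_mem' := fun _ => rfl
  mul_mem' := by
    intro x y hx hy i
    exact (hx (y i)).trans (hy i)
  inv_mem' := by
    intro x hx i
    have := hx (x⁻¹ i)
    rw [← Equiv.Perm.mul_apply, mul_inv_cancel, Equiv.Perm.one_apply] at this
    exact this.symm

theorem mem_colour {U : Fin 4 → Bool} {s : P} : s ∈ colour U ↔ ∀ i, U (s i) = U i := Iff.rfl

theorem trans_of (ρ : S →* P) (ht : ∀ i, ∃ s, ρ s 0 = i) :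
    Trans (ρ (gen 0)) (ρ (gen 1)) (ρ (gen 4)) := by
  intro U hU ha hb he i
  rw [← mem_colour] at ha hb he
  have hd : ρ (gen 3) ∈ colour U := by
    rw [d_eq (gen_rels.map ρ)]
    exact mul_mem (mul_mem hb ha) hb
  have hc : ρ (gen 2) ∈ colour U := by
    rw [c_eq (gen_rels.map ρ)]
    exact mul_mem (mul_mem (mul_mem (mul_mem hb ha) hb) (inv_mem he)) (inv_mem he)
  have hall : ∀ s, ρ s ∈ colour U := by
    intro s
    have h1 : s ∈ Subgroup.closure (Set.range gen) := by
      have : Subgroup.closure (Set.range gen) = ⊤ := PresentedGroup.closure_range_of _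
      rw [this]; trivial
    have h2 : Subgroup.closure (Set.range gen) ≤ (colour U).comap ρ := by
      rw [Subgroup.closure_le]
      rintro _ ⟨k, rfl⟩
      fin_cases k
      · exact ha
      · exact hb
      · exact hc
      · exact hd
      · exact he
    exact h2 h1
  obtain ⟨s, rfl⟩ := ht i
  rw [hall s 0, hU]

theorem exists_act (ρ : S →* P) (ht : ∀ i, ∃ s, ρ s 0 = i) :
    ∃ r, ∃ σ : P, ∀ s, ρ s = σ * act r s * σ⁻¹ := by
  have hR := gen_rels.map ρ
  have ha := hR.2.2.1
  have hb := hR.2.2.2.1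
  obtain ⟨g1, g2, g3⟩ := rels_abe hR
  obtain ⟨r, σ, h0, h1, h4⟩ := enum _ _ _ ha hb g1 g2 g3 (trans_of ρ ht)
  refine ⟨r, σ, fun s => ?_⟩
  have key : ρ = (MulAut.conj σ).toMonoidHom.comp (act r) := by
    apply eq_of_rels
    · change _ = σ * act r (gen 0) * σ⁻¹
      rw [act_gen, ← h0, mul_inv_cancel_right]
    · change _ = σ * act r (gen 1) * σ⁻¹
      rw [act_gen, ← h1, mul_inv_cancel_right]
    · change _ = σ * act r (gen 4) * σ⁻¹
      rw [act_gen, ← h4, mul_inv_cancel_right]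
  exact DFunLike.congr_fun key s

theorem exists_perm (K : Subgroup S) (hK : K.index = 4) :
    ∃ ρ : S →* P, (∀ i, ∃ s, ρ s 0 = i) ∧ ∀ s, s ∈ K ↔ ρ s 0 = 0 := by
  have hc : Nat.card (S ⧸ K) = 4 := hK
  have : Finite (S ⧸ K) := Nat.finite_of_card_ne_zero (by omega)
  let E0 : S ⧸ K ≃ Fin 4 := Finite.equivFinOfCardEq hc
  let E : S ⧸ K ≃ Fin 4 := E0.trans (Equiv.swap (E0 ((1 : S) : S ⧸ K)) 0)
  have hE : E.symm 0 = ((1 : S) : S ⧸ K) := by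
    rw [Equiv.symm_apply_eq]
    simp [E]
  let ρ : S →* P :=
    { toFun := fun s => (E.symm.trans (MulAction.toPerm s)).trans E
      map_one' := by ext i; simp
      map_mul' := fun x y => by ext i; simp [mul_smul] }
  have hρ : ∀ s, ρ s 0 = E (s : S ⧸ K) := by
    intro s
    change E (s • E.symm 0) = _
    rw [hE]
    congr 1
    change ((s * 1 : S) : S ⧸ K) = _
    rw [mul_one]
  refine ⟨ρ, fun i => ?_, fun s => ?_⟩
  · obtain ⟨s, hs⟩ := QuotientGroup.mk_surjective (E.symm i)
    exact ⟨s, by rw [hρ, hs, Equiv.apply_symm_apply]⟩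
  · rw [hρ, ← Equiv.eq_symm_apply, hE, eq_comm, QuotientGroup.eq]
    simp

theorem exists_conj (K : Subgroup S) (hK : K.index = 4) :
    ∃ r, ∃ g : S, MulAut.conj g • Kst (act r) = K := by
  obtain ⟨ρ, ht, hmem⟩ := exists_perm K hK
  obtain ⟨r, σ, hσ⟩ := exists_act ρ ht
  refine ⟨r, tr r (σ⁻¹ 0), ?_⟩
  ext s
  rw [Subgroup.mem_pointwise_smul_iff_inv_smul_mem, hmem, hσ, ← map_inv, MulAut.smul_def,
    MulAut.conj_apply, mem_Kst, inv_inv, map_mul, map_mul, map_inv]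
  simp only [Equiv.Perm.mul_apply]
  rw [act_tr, Equiv.Perm.inv_eq_iff_eq, act_tr]
  constructor
  · intro h
    rw [h, ← Equiv.Perm.mul_apply, mul_inv_cancel, Equiv.Perm.one_apply]
  · intro h
    rw [Equiv.Perm.eq_inv_iff_eq]
    exact h

theorem ab_conj (g : S) (H : Subgroup S) :
    Nonempty (Abelianization H ≃* Abelianization (MulAut.conj g • H : Subgroup S)) :=
  ⟨(Subgroup.equivSMul (MulAut.conj g) H).abelianizationCongr⟩

theorem not_iso (E : Multiplicative ℤ ≃* Multiplicative (ℤ × ZMod 2)) : False := by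
  let F : ℤ ≃+ ℤ × ZMod 2 := MulEquiv.toAdditive E
  have h1 : F.symm (0, 1) + F.symm (0, 1) = 0 := by
    rw [← map_add]
    have : ((0, 1) + (0, 1) : ℤ × ZMod 2) = 0 := by decide
    rw [this, map_zero]
  have h2 : F.symm (0, 1) = 0 := by omega
  rw [EmbeddingLike.map_eq_zero_iff] at h2
  exact absurd h2 (by decide)

theorem classify (K : Subgroup S) (hK : K.index = 4) (hi : Infinite (Abelianization K)) :
    (∃ g : S, MulAut.conj g • Kst (act 6) = K) ∨ ∃ g : S, MulAut.conj g • Kst (act 4) = K := by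
  obtain ⟨r, g, h⟩ := exists_conj K hK
  have hinf : Infinite (Abelianization (Kst (act r))) := by
    obtain ⟨E⟩ := ab_conj g (Kst (act r))
    rw [h] at E
    exact Infinite.of_injective _ E.symm.injective
  fin_cases r
  · exact absurd hinf fin0
  · exact absurd hinf fin1
  · exact absurd hinf fin2
  · exact absurd hinf fin3
  · exact Or.inr ⟨g, h⟩
  · exact absurd hinf fin5
  · exact Or.inl ⟨g, h⟩

theorem iso6 {K : Subgroup S} {g : S} (h : MulAut.conj g • Kst (act 6) = K) :
    Nonempty (Abelianization K ≃* Multiplicative ℤ) := by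
  subst h
  obtain ⟨E⟩ := ab_conj g (Kst (act 6))
  obtain ⟨F⟩ := isoZ
  exact ⟨E.symm.trans F⟩

theorem iso4 {K : Subgroup S} {g : S} (h : MulAut.conj g • Kst (act 4) = K) :
    Nonempty (Abelianization K ≃* Multiplicative (ℤ × ZMod 2)) := by
  subst h
  obtain ⟨E⟩ := ab_conj g (Kst (act 4))
  obtain ⟨F⟩ := isoZ2
  exact ⟨E.symm.trans F⟩

theorem conj_trans {H K L : Subgroup S} {g k : S} (h1 : MulAut.conj g • H = K)
    (h2 : MulAut.conj k • H = L) : ∃ x : S, MulAut.conj x • K = L := by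
  refine ⟨k * g⁻¹, ?_⟩
  rw [← h1, ← h2, smul_smul, ← map_mul, inv_mul_cancel_right]

end RileyS

/-- Every index-4 subgroup of `S` with infinite abelianization has abelianization `ℤ` or
`ℤ × ℤ/2ℤ`; both kinds occur; and any two index-4 subgroups with infinite and isomorphic
abelianizations are conjugate in `S`. -/
theorem S_index_four_subgroups :
    (∀ K : Subgroup S, K.index = 4 → Infinite (Abelianization K) →
        Nonempty (Abelianization K ≃* Multiplicative ℤ) ∨
          Nonempty (Abelianization K ≃* Multiplicative (ℤ × ZMod 2))) ∧
      (∃ K : Subgroup S, K.index = 4 ∧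
        Nonempty (Abelianization K ≃* Multiplicative ℤ)) ∧
      (∃ K : Subgroup S, K.index = 4 ∧
        Nonempty (Abelianization K ≃* Multiplicative (ℤ × ZMod 2))) ∧
      ∀ K₁ K₂ : Subgroup S, K₁.index = 4 → K₂.index = 4 →
        Infinite (Abelianization K₁) → Infinite (Abelianization K₂) →
        Nonempty (Abelianization K₁ ≃* Abelianization K₂) →
        ∃ g : S, MulAut.conj g • K₁ = K₂ := by
  refine ⟨fun K hK hi => ?_, ⟨RileyS.Kst (RileyS.act 6), ?_, RileyS.isoZ⟩,
    ⟨RileyS.Kst (RileyS.act 4), ?_, RileyS.isoZ2⟩, fun K₁ K₂ h1 h2 i1 i2 hE => ?_⟩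
  · rcases RileyS.classify K hK hi with ⟨g, h⟩ | ⟨g, h⟩
    · exact Or.inl (RileyS.iso6 h)
    · exact Or.inr (RileyS.iso4 h)
  · exact RileyS.index_Kst _ fun i => ⟨RileyS.tr 6 i, RileyS.act_tr 6 i⟩
  · exact RileyS.index_Kst _ fun i => ⟨RileyS.tr 4 i, RileyS.act_tr 4 i⟩
  · obtain ⟨E⟩ := hE
    rcases RileyS.classify K₁ h1 i1 with ⟨g, hg⟩ | ⟨g, hg⟩ <;>
      rcases RileyS.classify K₂ h2 i2 with ⟨k, hk⟩ | ⟨k, hk⟩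
    · exact RileyS.conj_trans hg hk
    · obtain ⟨A⟩ := RileyS.iso6 hg
      obtain ⟨B⟩ := RileyS.iso4 hk
      exact (RileyS.not_iso (A.symm.trans (E.trans B))).elim
    · obtain ⟨A⟩ := RileyS.iso4 hg
      obtain ⟨B⟩ := RileyS.iso6 hk
      exact (RileyS.not_iso (B.symm.trans (E.symm.trans A))).elim
    · exact RileyS.conj_trans hg hk
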